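/- arXiv:2404.14291 — 2 statements merged into one kernel-verified Lean document; each statement's English description precedes it below -/
import Mathlib

section
/- Let p be an odd prime, k and ℓ positive integers with k not dividing ℓ, q = p^k, Q = p^ℓ, and let ε ∈ F_{q²} with ε ≠ 0 and ε^{q+1} ≠ 1. Then the map f2 : F_{q²} → F_{q²} defined by f2(x) = x^{Q+q} + ε·x^{Q+1} is not planar. -/
/-- A function between (additive groups of) finite abelian groups is planar if every
nonzero-direction derivative hits every value exactly once. -/
def IsPlanarFn {G H : Type*} [AddGroup G] [AddGroup H] (f : G → H) : Prop :=
  ∀ a : G, a ≠ 0 → ∀ b : H, ∃! x : G, f (x + a) - f x = b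

section Planarity

open MvPolynomial

theorem sum_zmod_val {M : Type*} [AddCommMonoid M] (n : ℕ) [NeZero n] (f : ℕ → M) :
    ∑ s : ZMod n, f s.val = ∑ i ∈ Finset.range n, f i := by
  cases n with
  | zero => exact absurd rfl (NeZero.ne 0)
  | succ n => exact Fin.sum_univ_eq_sum_range f (n + 1)

theorem sum_sub_one_mul_pow_val (n r : ℕ) [NeZero n] (hr : 1 ≤ r) :
    ∑ s : ZMod n, (r - 1) * r ^ s.val = r ^ n - 1 := by
  rw [← Finset.mul_sum, sum_zmod_val n (fun i => r ^ i)]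
  zify [hr, Nat.one_le_pow n r hr]
  exact mul_geom_sum (r : ℤ) n

/-- A nonzero digit vector (with digits of any size) of a multiple of `r ^ n - 1`, with positions
modulo `n`, has digit sum greater than `n * (r - 1)`, unless all digits are `r - 1`. -/
theorem digits_eq_or_lt_sum (n r : ℕ) [NeZero n] (hr : 2 ≤ r) (e : ZMod n →₀ ℕ) (he : e ≠ 0)
    (hdvd : r ^ n - 1 ∣ ∑ s, e s * r ^ s.val) :
    (∀ s, e s = r - 1) ∨ n * (r - 1) < ∑ s, e s := by
  induction hN : ∑ s, e s using Nat.strong_induction_on generalizing e with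
  | _ N ih =>
  subst hN
  by_cases hbig : ∃ s, r ≤ e s
  · obtain ⟨s, hs⟩ := hbig
    obtain ⟨e₀, rfl⟩ : ∃ e₀ : ZMod n →₀ ℕ, e = e₀ + Finsupp.single s r :=
      ⟨e - Finsupp.single s r, (tsub_add_cancel_of_le (Finsupp.single_le_iff.2 hs)).symm⟩
    have hsum : ∀ (t : ZMod n) (x : ℕ), ∑ i, (e₀ + Finsupp.single t x) i = ∑ i, e₀ i + x := by
      intro t x
      simp [Finset.sum_add_distrib, Finsupp.single_apply]
    have hwt : ∀ (t : ZMod n) (x : ℕ), ∑ i, (e₀ + Finsupp.single t x) i * r ^ i.val =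
        ∑ i, e₀ i * r ^ i.val + x * r ^ t.val := by
      intro t x
      simp [add_mul, Finset.sum_add_distrib, Finsupp.single_apply]
    have hcong : ((r ^ (s + 1).val : ℕ) : ZMod (r ^ n - 1)) = ((r * r ^ s.val : ℕ) : ZMod _) := by
      have hone : (r : ZMod (r ^ n - 1)) ^ n = 1 := by
        have h := ZMod.natCast_self (r ^ n - 1)
        rw [Nat.cast_sub (Nat.one_le_pow n r (by omega))] at h
        push_cast at h
        exact sub_eq_zero.1 h
      push_cast
      rw [← pow_succ', ZMod.val_add, pow_eq_pow_mod (s.val + 1) hone, ZMod.val_one_eq_one_mod,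
        Nat.add_mod_mod]
    have hdvd' : r ^ n - 1 ∣ ∑ i, (e₀ + Finsupp.single (s + 1) 1 : ZMod n →₀ ℕ) i * r ^ i.val := by
      rw [← ZMod.natCast_eq_zero_iff] at hdvd ⊢
      rw [hwt] at hdvd ⊢
      rw [one_mul, Nat.cast_add, hcong, ← Nat.cast_add]
      exact hdvd
    have hne : e₀ + Finsupp.single (s + 1) 1 ≠ 0 := by
      intro h
      have := DFunLike.congr_fun h (s + 1)
      simp at this
    have hs1 := hsum s r
    have hs2 := hsum (s + 1) 1
    right
    rcases ih _ (by rw [hs1, hs2]; omega) _ hne hdvd' rfl with h | h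
    · rw [Finset.sum_congr rfl fun i _ => h i] at hs2
      simp only [Finset.sum_const, Finset.card_univ, ZMod.card, smul_eq_mul] at hs2
      omega
    · omega
  · push Not at hbig
    left
    have hle : ∀ s ∈ Finset.univ, e s * r ^ s.val ≤ (r - 1) * r ^ s.val := fun s _ =>
      Nat.mul_le_mul_right _ (by have := hbig s; omega)
    have hpos : 0 < ∑ s, e s * r ^ s.val := by
      obtain ⟨s, hs⟩ := Finsupp.ne_iff.1 he
      refine Finset.sum_pos' (fun _ _ => Nat.zero_le _) ⟨s, Finset.mem_univ _, ?_⟩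
      exact Nat.mul_pos (Nat.pos_of_ne_zero hs) (by positivity)
    have heq := le_antisymm (Finset.sum_le_sum hle)
      (by rw [sum_sub_one_mul_pow_val n r (by omega)]; exact Nat.le_of_dvd hpos hdvd)
    intro s
    exact Nat.eq_of_mul_eq_mul_right (by positivity)
      ((Finset.sum_eq_sum_iff_of_le hle).1 heq s (Finset.mem_univ s))

/-- The vector all of whose digits are `r - 1`. -/
noncomputable def topDigits (n r : ℕ) [NeZero n] : ZMod n →₀ ℕ :=
  Finsupp.equivFunOnFinite.symm fun _ => r - 1

theorem sum_topDigits (n r : ℕ) [NeZero n] : ∑ s, topDigits n r s = n * (r - 1) := by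
  simp [topDigits, ZMod.card]

/-- Summing a polynomial of degree at most `n * (r - 1)` in the Frobenius powers over the
`-1`-eigenspace `V` of the `r ^ n`-power map extracts its top coefficient. -/
theorem sum_eval_frobenius_powers {F : Type*} [Field F] (n r : ℕ) [NeZero n] (hr : 2 ≤ r)
    (V : Finset F) (hV : ∀ v, v ∈ V ↔ v ^ r ^ n = -v) (hcard : (V.card : F) = 0)
    (hu : ∃ u : F, u ^ r ^ n = u ∧ orderOf u = r ^ n - 1)
    (Φ : MvPolynomial (ZMod n) F) (hΦ : Φ.totalDegree ≤ n * (r - 1)) :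
    ∑ v ∈ V, eval (fun s => v ^ r ^ s.val) Φ = coeff (topDigits n r) Φ := by
  classical
  have hrn : 2 ≤ r ^ n := le_trans hr (Nat.le_self_pow (NeZero.ne n) r)
  have hmono : ∀ d : ZMod n →₀ ℕ, ∑ s, d s ≤ n * (r - 1) →
      ∑ v ∈ V, v ^ (∑ s, d s * r ^ s.val) = if d = topDigits n r then (1 : F) else 0 := by
    intro d hd
    split_ifs with htop
    · have hexp : ∑ s, d s * r ^ s.val = r ^ n - 1 := by
        rw [htop, ← sum_sub_one_mul_pow_val n r (by omega)]
        rfl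
      rw [hexp]
      have h0 : (0 : F) ∈ V := by rw [hV]; simp [show r ≠ 0 by omega]
      rw [← Finset.sum_erase_add _ _ h0]
      have hval : ∀ v ∈ V.erase 0, v ^ (r ^ n - 1) = -1 := by
        intro v hv
        rw [Finset.mem_erase, hV] at hv
        apply mul_right_cancel₀ hv.1
        rw [← pow_succ, Nat.sub_add_cancel (by omega), hv.2, neg_one_mul]
      rw [Finset.sum_congr rfl hval, zero_pow (by omega), Finset.sum_const, add_zero,
        Finset.card_erase_of_mem h0, nsmul_eq_mul,
        Nat.cast_sub (Finset.card_pos.2 ⟨0, h0⟩), hcard]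
      simp
    · by_cases hd0 : d = 0
      · simp [hd0, hcard]
      obtain ⟨u, huq, hord⟩ := hu
      have hu0 : u ≠ 0 := by
        rintro rfl
        rw [orderOf_eq_zero (by
          rw [isOfFinOrder_iff_pow_eq_one]
          rintro ⟨m, hm, h⟩
          rw [zero_pow hm.ne'] at h
          exact zero_ne_one h)] at hord
        omega
      have hndvd : ¬ r ^ n - 1 ∣ ∑ s, d s * r ^ s.val := by
        intro hdvd
        rcases digits_eq_or_lt_sum n r hr d hd0 hdvd with h | h
        · exact htop (Finsupp.ext h)
        · omega
      set E := ∑ s, d s * r ^ s.val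
      have hshift : ∑ v ∈ V, v ^ E = u ^ E * ∑ v ∈ V, v ^ E := by
        rw [Finset.mul_sum]
        symm
        refine Finset.sum_bij' (fun v _ => u * v) (fun v _ => u⁻¹ * v) ?_ ?_ ?_ ?_ ?_
        · intro v hv
          rw [hV] at hv ⊢
          rw [mul_pow, huq, hv, mul_neg]
        · intro v hv
          rw [hV] at hv ⊢
          rw [mul_pow, inv_pow, huq, hv, mul_neg]
        · intro v _
          field_simp
        · intro v _
          field_simp
        · intro v _
          rw [mul_pow]
      have hne : u ^ E ≠ 1 := fun h => hndvd (hord ▸ orderOf_dvd_of_pow_eq_one h)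
      have : (u ^ E - 1) * ∑ v ∈ V, v ^ E = 0 := by linear_combination -hshift
      exact (mul_eq_zero.1 this).resolve_left (sub_ne_zero.2 hne)
  simp_rw [eval_eq']
  rw [Finset.sum_comm]
  have hterm : ∀ d ∈ Φ.support, ∑ v ∈ V, coeff d Φ * ∏ s, (v ^ r ^ s.val) ^ d s =
      if d = topDigits n r then coeff d Φ else 0 := by
    intro d hd
    rw [← Finset.mul_sum]
    have hpow : ∀ v : F, ∏ s : ZMod n, (v ^ r ^ s.val) ^ d s = v ^ (∑ s, d s * r ^ s.val) := by
      intro v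
      rw [← Finset.prod_pow_eq_pow_sum]
      exact Finset.prod_congr rfl fun s _ => by rw [← pow_mul, mul_comm]
    simp_rw [hpow]
    rw [hmono d, mul_ite, mul_one, mul_zero]
    refine le_trans ?_ hΦ
    rw [← Finsupp.sum_fintype d (fun _ x => x) (fun _ => rfl)]
    exact le_totalDegree hd
  rw [Finset.sum_congr rfl hterm, Finset.sum_ite_eq']
  split_ifs with h
  · rfl
  · exact (notMem_support_iff.1 h).symm

/-- For odd `n` and a generator `g` of `ZMod n`, there is an "every other element" set along the
cycle `0, g, 2 * g, …`, whose only pair of adjacent elements is `0, g`. -/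
theorem exists_alternating_set (n : ℕ) [NeZero n] (hn : Odd n) (h1 : 1 < n) (g : ZMod n)
    (hg : IsUnit g) :
    ∃ Z : Finset (ZMod n), 0 ∈ Z ∧ g ∈ Z ∧ ∀ s, s + g ∉ Z ↔ s ≠ 0 ∧ s ∈ Z := by
  classical
  obtain ⟨u, rfl⟩ := hg
  refine ⟨Finset.univ.filter fun s => (s * ↑u⁻¹).val = 0 ∨ Odd (s * ↑u⁻¹ : ZMod n).val,
    by simp, by simp [ZMod.val_one'' h1.ne'], fun s => ?_⟩
  obtain ⟨i, rfl⟩ : ∃ i : ZMod n, s = i * u := ⟨s * ↑u⁻¹, by simp⟩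
  have hi : i * u + u = (i + 1) * u := by ring
  simp only [hi, Finset.mem_filter_univ, Units.mul_inv_cancel_right]
  rw [ne_eq, u.isUnit.mul_left_eq_zero, ← ZMod.val_eq_zero i, ZMod.val_add,
    ZMod.val_one'' h1.ne']
  have hlt := ZMod.val_lt i
  rcases Nat.lt_or_ge (i.val + 1) n with h | h
  · rw [Nat.mod_eq_of_lt h]
    simp only [Nat.odd_iff]
    omega
  · have : i.val + 1 = n := by omega
    rw [this, Nat.mod_self]
    simp only [Nat.odd_iff, true_or, not_true, false_iff] at hn ⊢
    omega

theorem map_erase_zero_eq_compl (n : ℕ) [NeZero n] (g : ZMod n) (Z : Finset (ZMod n))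
    (hZ : ∀ s, s + g ∉ Z ↔ s ≠ 0 ∧ s ∈ Z) :
    (Z.erase 0).map (addRightEmbedding g) = Zᶜ := by
  ext t
  have := hZ (t - g)
  rw [sub_add_cancel] at this
  rw [Finset.mem_compl, this, Finset.mem_map]
  constructor
  · rintro ⟨s, hs, rfl⟩
    simpa using Finset.mem_erase.1 hs
  · exact fun h => ⟨t - g, Finset.mem_erase.2 h, by simp⟩

theorem two_mul_card_alternating_set (n : ℕ) [NeZero n] (g : ZMod n) (Z : Finset (ZMod n))
    (h0Z : 0 ∈ Z) (hZ : ∀ s, s + g ∉ Z ↔ s ≠ 0 ∧ s ∈ Z) : 2 * Z.card = n + 1 := by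
  classical
  have hmap := map_erase_zero_eq_compl n g Z hZ
  have h := congrArg Finset.card hmap
  have := Finset.card_pos.2 ⟨0, h0Z⟩
  have := Z.card_le_univ
  rw [Finset.card_map, Finset.card_erase_of_mem h0Z, Finset.card_compl, ZMod.card] at h
  rw [ZMod.card] at this
  omega

section Truncated

variable {A : Type*} [CommRing A]

theorem mul_pow_congr {z u w : A} (h : z * u = z * w) (k : ℕ) : z * u ^ k = z * w ^ k := by
  induction k with
  | zero => simp
  | succ k ih => rw [pow_succ, pow_succ, ← mul_assoc, ih, mul_right_comm, h, mul_right_comm,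
      ← mul_assoc]

theorem mul_prod_congr {ι : Type*} {z : A} (S : Finset ι) {f h : ι → A}
    (H : ∀ s ∈ S, z * f s = z * h s) : z * ∏ s ∈ S, f s = z * ∏ s ∈ S, h s := by
  classical
  induction S using Finset.induction_on with
  | empty => simp
  | insert a S ha ih =>
    rw [Finset.prod_insert ha, Finset.prod_insert ha, ← mul_assoc, H a (by simp), mul_right_comm,
      ih fun s hs => H s (by simp [hs])]
    ring

variable {F : Type*} [Field F] [Algebra F A]

local notation "κ" => algebraMap F A

theorem binary_forms_mul_eq {m : ℕ}
    (hadd : ∀ x w : A, (x + w) ^ (m + 1) = x ^ (m + 1) + w ^ (m + 1))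
    {x y : A} (hx : x ^ (m + 1) = 0) (hy : y ^ (m + 1) = 0) {a a' b b' : F} (ha : a ≠ 0)
    (hdet : a * b' - a' * b ≠ 0) :
    ∃ c : F, c ≠ 0 ∧
      (κ a * x + κ a' * y) ^ m * (κ b * x + κ b' * y) ^ m = κ c * (x ^ m * y ^ m) := by
  set z := κ a * x + κ a' * y with hz
  set c₁ := b' - b * a' / a with hc₁
  have hc₁0 : c₁ ≠ 0 := by
    intro h
    apply hdet
    rw [hc₁] at h
    field_simp at h
    linear_combination h
  have hw : κ b * x + κ b' * y = κ (b / a) * z + κ c₁ * y := by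
    have hb : b = b / a * a := by field_simp
    have hb' : b' = b / a * a' + c₁ := by rw [hc₁]; ring
    rw [hz]
    conv_lhs => rw [hb, hb']
    simp only [map_mul, map_add]
    ring
  have hz0 : z ^ m * z = 0 := by
    rw [← pow_succ, hz, hadd, mul_pow, mul_pow, hx, hy, mul_zero, mul_zero, add_zero]
  have hy0 : y ^ m * y = 0 := by rw [← pow_succ, hy]
  refine ⟨a ^ m * c₁ ^ m, mul_ne_zero (pow_ne_zero _ ha) (pow_ne_zero _ hc₁0), ?_⟩
  rw [hw, mul_pow_congr (w := κ c₁ * y) (by linear_combination κ (b / a) * hz0), mul_pow,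
    mul_left_comm, mul_comm (z ^ m),
    mul_pow_congr (w := κ a * x) (by rw [hz]; linear_combination κ a' * hy0)]
  simp only [map_mul, map_pow]
  ring

theorem prod_forms_eq (n e : ℕ) [NeZero n]
    (hadd : ∀ x w : A, (x + w) ^ (2 * e + 1) = x ^ (2 * e + 1) + w ^ (2 * e + 1))
    (y : ZMod n → A) (hy : ∀ s, y s ^ (2 * e + 1) = 0) (g : ZMod n) (hg : g ≠ 0)
    (Z : Finset (ZMod n)) (h0Z : 0 ∈ Z) (hgZ : g ∈ Z) (hZ : ∀ s, s + g ∉ Z ↔ s ≠ 0 ∧ s ∈ Z)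
    {a a' b b' : F} (ha : a ≠ 0) (hdet : a * b' - a' * b ≠ 0)
    (β β' : ZMod n → F) (hβ : ∀ s, β s ≠ 0) (hβ' : ∀ s, β' s ≠ 0) :
    ∃ c : F, c ≠ 0 ∧
      ((κ a * y g + κ a' * y 0) ^ (2 * e) * (κ b * y g + κ b' * y 0) ^ (2 * e)) *
        (∏ s ∈ Finset.univ.erase 0, (κ (β s) * y (s + g) + κ (β' s) * y s) ^ e) *
        ∏ s ∈ (Z.erase 0).erase g, y s ^ (2 * e) = κ c * ∏ s, y s ^ (2 * e) := by
  classical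
  obtain ⟨c, hc, hbin⟩ := binary_forms_mul_eq hadd (hy g) (hy 0) ha hdet
  set yZ := ∏ s ∈ Z, y s ^ (2 * e) with hyZ
  have hkill : ∀ s ∈ Z, yZ * y s = 0 := by
    intro s hs
    rw [hyZ, ← Finset.mul_prod_erase _ _ hs, mul_right_comm, ← pow_succ, hy, zero_mul]
  have hsplit : y g ^ (2 * e) * y 0 ^ (2 * e) * ∏ s ∈ (Z.erase 0).erase g, y s ^ (2 * e) = yZ := by
    rw [hyZ, ← Finset.mul_prod_erase _ _ h0Z,
      ← Finset.mul_prod_erase (Z.erase 0) _ (Finset.mem_erase.2 ⟨hg, hgZ⟩)]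
    ring
  set γ : ZMod n → F := fun s => if s ∈ Z then β s else β' s with hγ
  set o : ZMod n → ZMod n := fun s => if s ∈ Z then s + g else s with ho
  have hstep : yZ * ∏ s ∈ Finset.univ.erase 0, (κ (β s) * y (s + g) + κ (β' s) * y s) ^ e =
      yZ * ∏ s ∈ Finset.univ.erase 0, (κ (γ s) * y (o s)) ^ e := by
    refine mul_prod_congr _ fun s hs => mul_pow_congr ?_ e
    have hs0 : s ≠ 0 := (Finset.mem_erase.1 hs).1
    by_cases hsZ : s ∈ Z
    · simp only [hγ, ho, if_pos hsZ]
      linear_combination κ (β' s) * hkill s hsZ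
    · have : s + g ∈ Z := by
        by_contra h
        exact hsZ ((hZ s).1 h).2
      simp only [hγ, ho, if_neg hsZ]
      linear_combination κ (β s) * hkill _ this
  have hmap := map_erase_zero_eq_compl n g Z hZ
  have hcompl : ∏ s ∈ Finset.univ.erase 0, y (o s) ^ e = ∏ s ∈ Zᶜ, y s ^ (2 * e) := by
    have hu : Finset.univ.erase (0 : ZMod n) = Z.erase 0 ∪ Zᶜ := by
      ext s
      by_cases hs : s ∈ Z
      · simp [hs]
      · have : s ≠ 0 := fun h => hs (h ▸ h0Z)
        simp [hs, this]
    have hd : Disjoint (Z.erase 0) Zᶜ :=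
      Finset.disjoint_left.2 fun s hs hs' => Finset.mem_compl.1 hs' (Finset.mem_of_mem_erase hs)
    rw [hu, Finset.prod_union hd]
    have h1 : ∏ s ∈ Z.erase 0, y (o s) ^ e = ∏ s ∈ Zᶜ, y s ^ e := by
      rw [← hmap, Finset.prod_map]
      refine Finset.prod_congr rfl fun s hs => ?_
      simp [ho, Finset.mem_of_mem_erase hs]
    have h2 : ∏ s ∈ Zᶜ, y (o s) ^ e = ∏ s ∈ Zᶜ, y s ^ e :=
      Finset.prod_congr rfl fun s hs => by simp [ho, Finset.mem_compl.1 hs]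
    rw [h1, h2, ← Finset.prod_mul_distrib]
    exact Finset.prod_congr rfl fun s _ => by rw [two_mul, pow_add]
  refine ⟨c * ∏ s ∈ Finset.univ.erase 0, γ s ^ e, mul_ne_zero hc
    (Finset.prod_ne_zero_iff.2 fun s _ => pow_ne_zero _ ?_), ?_⟩
  · simp only [hγ]
    split_ifs
    exacts [hβ s, hβ' s]
  · simp_rw [mul_pow] at hstep
    rw [Finset.prod_mul_distrib, hcompl, mul_left_comm, hyZ, Finset.prod_mul_prod_compl, ← hyZ,
      ← hsplit] at hstep
    rw [hbin]
    simp only [map_mul, map_prod, map_pow]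
    linear_combination κ c * hstep

end Truncated

theorem coeff_topDigits_of_mem_span {F : Type*} [Field F] (n r : ℕ) [NeZero n] (hr : 1 ≤ r)
    {Φ : MvPolynomial (ZMod n) F}
    (h : Φ ∈ Ideal.span (Set.range fun s : ZMod n => (X s : MvPolynomial (ZMod n) F) ^ r)) :
    coeff (topDigits n r) Φ = 0 := by
  classical
  refine Submodule.closure_induction (p := fun Φ _ => coeff (topDigits n r) Φ = 0) ?_ ?_ ?_ h
  · simp
  · intro x y _ _ hx hy
    rw [coeff_add, hx, hy, add_zero]
  · rintro q _ ⟨s, rfl⟩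
    simp only [smul_eq_mul, X_pow_eq_monomial]
    rw [coeff_mul_monomial', if_neg]
    intro hle
    have := hle s
    simp [topDigits] at this
    omega

theorem coeff_topDigits_prod_forms_ne_zero {F : Type*} [Field F] (p d n e : ℕ) [Fact p.Prime]
    [CharP F p] [NeZero n] (hr : 2 * e + 1 = p ^ d) (g : ZMod n) (hg : g ≠ 0)
    (Z : Finset (ZMod n)) (h0Z : 0 ∈ Z) (hgZ : g ∈ Z) (hZ : ∀ s, s + g ∉ Z ↔ s ≠ 0 ∧ s ∈ Z)
    {a a' b b' : F} (ha : a ≠ 0) (hdet : a * b' - a' * b ≠ 0)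
    (β β' : ZMod n → F) (hβ : ∀ s, β s ≠ 0) (hβ' : ∀ s, β' s ≠ 0) :
    coeff (topDigits n (2 * e + 1))
      (((C a * X g + C a' * X 0) ^ (2 * e) * (C b * X g + C b' * X 0) ^ (2 * e)) *
        (∏ s ∈ Finset.univ.erase 0, (C (β s) * X (s + g) + C (β' s) * X s) ^ e) *
        ∏ s ∈ (Z.erase 0).erase g, X s ^ (2 * e)) ≠ 0 := by
  classical
  set J := Ideal.span (Set.range fun s : ZMod n => (X s : MvPolynomial (ZMod n) F) ^ (2 * e + 1))
  have hadd : ∀ x w : MvPolynomial (ZMod n) F ⧸ J,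
      (x + w) ^ (2 * e + 1) = x ^ (2 * e + 1) + w ^ (2 * e + 1) := by
    intro x w
    obtain ⟨x, rfl⟩ := Ideal.Quotient.mk_surjective x
    obtain ⟨w, rfl⟩ := Ideal.Quotient.mk_surjective w
    rw [← map_add, ← map_pow, ← map_pow, ← map_pow, ← map_add, hr, add_pow_char_pow]
  obtain ⟨c, hc, h⟩ := prod_forms_eq (F := F) n e hadd (fun s => Ideal.Quotient.mk J (X s))
    (fun s => by
      rw [← map_pow, Ideal.Quotient.eq_zero_iff_mem]
      exact Ideal.subset_span ⟨s, rfl⟩) g hg Z h0Z hgZ hZ ha hdet β β' hβ hβ'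
  have halg : ∀ x : F, algebraMap F (MvPolynomial (ZMod n) F ⧸ J) x = Ideal.Quotient.mk J (C x) :=
    fun _ => rfl
  simp only [halg, ← map_mul, ← map_add, ← map_pow, ← map_prod] at h
  have hmem := coeff_topDigits_of_mem_span n _ (by omega) (Ideal.Quotient.eq.1 h)
  rw [coeff_sub, sub_eq_zero] at hmem
  rw [hmem]
  have hmon : ∏ s : ZMod n, (X s : MvPolynomial (ZMod n) F) ^ (2 * e) =
      monomial (topDigits n (2 * e + 1)) 1 := by
    rw [monomial_eq, Finsupp.prod_fintype _ _ (by simp)]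
    simp [topDigits]
  rw [hmon, coeff_C_mul, coeff_monomial, if_pos rfl, mul_one]
  exact hc

theorem pow_pow_eq_of_pow_eq_neg {F : Type*} [Field F] {r n : ℕ} (hr : Odd r) {v : F}
    (hv : v ^ r ^ n = -v) (m : ℕ) : v ^ r ^ m = (-1) ^ (m / n) * v ^ r ^ (m % n) := by
  have key : ∀ j t : ℕ, v ^ r ^ (n * j + t) = (-1) ^ j * v ^ r ^ t := by
    intro j t
    induction j with
    | zero => simp
    | succ j ih =>
      rw [show n * (j + 1) + t = n + (n * j + t) by ring, pow_add, pow_mul, hv, hr.pow.neg_pow, ih]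
      ring
  rw [← key, Nat.div_add_mod]

section FrobeniusForms

variable {F : Type*} [Field F] (r n l : ℕ)

/-- The linear form in the Frobenius powers `X s` of `v` representing the
`r ^ s`-th power of `a * v ^ r ^ l + a' * v` when `v ^ r ^ n = -v`. -/
noncomputable def frobeniusForm (a a' : F) (s : ZMod n) : MvPolynomial (ZMod n) F :=
  C (a ^ r ^ s.val * (-1) ^ ((l + s.val) / n)) * X (s + (l : ZMod n)) + C (a' ^ r ^ s.val) * X s

theorem totalDegree_frobeniusForm_le (a a' : F) (s : ZMod n) :
    (frobeniusForm r n l a a' s).totalDegree ≤ 1 := by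
  have h : ∀ (c : F) (t : ZMod n), (C c * X t : MvPolynomial (ZMod n) F).totalDegree ≤ 1 :=
    fun c t => (totalDegree_mul _ _).trans (by simp)
  exact (totalDegree_add _ _).trans (max_le (h _ _) (h _ _))

theorem frobeniusForm_zero [NeZero n] (a a' : F) :
    frobeniusForm r n l a a' 0 = C (a * (-1) ^ (l / n)) * X (l : ZMod n) + C a' * X 0 := by
  simp [frobeniusForm]

theorem eval_frobeniusForm {p d : ℕ} [Fact p.Prime] [CharP F p] [NeZero n] (hrp : r = p ^ d)
    (hr : Odd r) (a a' : F) (s : ZMod n) {v : F} (hv : v ^ r ^ n = -v) :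
    eval (fun t : ZMod n => v ^ r ^ t.val) (frobeniusForm r n l a a' s) =
      (a * v ^ r ^ l + a' * v) ^ r ^ s.val := by
  have h := pow_pow_eq_of_pow_eq_neg hr hv (l + s.val)
  have hval : (s + (l : ZMod n)).val = (l + s.val) % n := by
    rw [add_comm, ZMod.val_add, ZMod.val_natCast, Nat.mod_add_mod]
  have hadd : ∀ x y : F, (x + y) ^ r ^ s.val = x ^ r ^ s.val + y ^ r ^ s.val := by
    intro x y
    rw [hrp, ← pow_mul, add_pow_char_pow]
  rw [hadd, mul_pow, mul_pow, ← pow_mul, ← pow_add, h]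
  simp only [frobeniusForm, map_add, map_mul, eval_C, eval_X, hval]
  ring

end FrobeniusForms

theorem totalDegree_prod_pow_le {σ F : Type*} [Field F] {ι : Type*} (S : Finset ι)
    (f : ι → MvPolynomial σ F) (k : ℕ) (hf : ∀ s, (f s).totalDegree ≤ 1) :
    (∏ s ∈ S, f s ^ k).totalDegree ≤ S.card * k := by
  refine (totalDegree_finsetProd _ _).trans ((Finset.sum_le_card_nsmul _ _ k fun s _ => ?_).trans
    (by simp))
  exact (totalDegree_pow _ _).trans ((Nat.mul_le_mul_left _ (hf s)).trans (by simp))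

theorem totalDegree_pow_le_of_le_one {σ F : Type*} [Field F] {f : MvPolynomial σ F} (k : ℕ)
    (hf : f.totalDegree ≤ 1) : (f ^ k).totalDegree ≤ k :=
  (totalDegree_pow _ _).trans ((Nat.mul_le_mul_left _ hf).trans (by simp))

/-- Two linear binomials cannot agree up to a constant after raising to the power
`(q - 1) / 2` or `(q + 1) / 2` on the `-1`-eigenspace of the `q`-power map, `q = r ^ n`. -/
theorem false_of_pow_eq_mul_pow {F : Type*} [Field F] (p d n l e i : ℕ) [Fact p.Prime] [CharP F p]
    [NeZero n] (hr : 2 * e + 1 = p ^ d) (he : 1 ≤ e) (hn : Odd n) (hn1 : 1 < n)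
    (hl : l.Coprime n) (V : Finset F) (hV : ∀ v, v ∈ V ↔ v ^ (2 * e + 1) ^ n = -v)
    (hcard : (V.card : F) = 0)
    (hu : ∃ u : F, u ^ (2 * e + 1) ^ n = u ∧ orderOf u = (2 * e + 1) ^ n - 1)
    {a a' b b' c : F} (ha : a ≠ 0) (hb : b ≠ 0) (hb' : b' ≠ 0)
    (hdet : a * b' - a' * b ≠ 0) (hc : c ≠ 0) (hi : i ≤ 1)
    (h : ∀ v ∈ V, (a * v ^ (2 * e + 1) ^ l + a' * v) ^ (((2 * e + 1) ^ n - 1) / 2 + i) =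
      c * (b * v ^ (2 * e + 1) ^ l + b' * v) ^ (((2 * e + 1) ^ n - 1) / 2 + i)) : False := by
  classical
  set r := 2 * e + 1 with hrdef
  have hrodd : Odd r := ⟨e, rfl⟩
  have hgu : IsUnit (l : ZMod n) := (ZMod.isUnit_iff_coprime l n).2 hl
  have hg : (l : ZMod n) ≠ 0 := by
    have : Fact (1 < n) := ⟨hn1⟩
    exact hgu.ne_zero
  obtain ⟨Z, h0Z, hgZ, hZ⟩ := exists_alternating_set n hn hn1 l hgu
  have hZcard := two_mul_card_alternating_set n l Z h0Z hZ
  set Y : MvPolynomial (ZMod n) F := ∏ s ∈ (Z.erase 0).erase (l : ZMod n), X s ^ (2 * e) with hY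
  have hYdeg : Y.totalDegree ≤ (Z.card - 2) * (2 * e) := by
    refine (totalDegree_prod_pow_le _ _ _ fun s => (totalDegree_X s).le).trans_eq ?_
    rw [Finset.card_erase_of_mem (Finset.mem_erase.2 ⟨hg, hgZ⟩), Finset.card_erase_of_mem h0Z,
      Nat.sub_sub]
  have hcardu : (Finset.univ.erase (0 : ZMod n)).card = n - 1 := by
    rw [Finset.card_erase_of_mem (Finset.mem_univ _), Finset.card_univ, ZMod.card]
  have hLdeg : ∀ x x' s, (frobeniusForm r n l x x' s : MvPolynomial (ZMod n) F).totalDegree ≤ 1 :=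
    totalDegree_frobeniusForm_le r n l
  have hprod : ∀ x x' : F, (∏ s ∈ Finset.univ.erase (0 : ZMod n),
      frobeniusForm r n l x x' s ^ e).totalDegree ≤ (n - 1) * e := fun x x' =>
    (totalDegree_prod_pow_le _ _ _ (hLdeg x x')).trans_eq (by rw [hcardu])
  have htot : (n - 1) * e + (Z.card - 2) * (2 * e) + 4 * e = n * (r - 1) := by
    obtain ⟨m, hm⟩ : ∃ m, n = 2 * m + 3 := by
      obtain ⟨m, hm⟩ := hn
      exact ⟨m - 1, by omega⟩
    obtain hz : Z.card - 2 = m := by omega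
    rw [hz, hm, hrdef, Nat.add_sub_cancel, show 2 * m + 3 - 1 = 2 * m + 2 by omega]
    ring
  set Φ₁ : MvPolynomial (ZMod n) F := frobeniusForm r n l a a' 1 *
    frobeniusForm r n l a a' 0 ^ (e - 1 + i) *
    (∏ s ∈ Finset.univ.erase 0, frobeniusForm r n l a a' s ^ e) *
    frobeniusForm r n l b b' 0 ^ (e - i) * Y with hΦ₁
  set Φ₂ : MvPolynomial (ZMod n) F := (frobeniusForm r n l a a' 0 ^ (2 * e) *
    frobeniusForm r n l b b' 0 ^ (2 * e)) *
    (∏ s ∈ Finset.univ.erase 0, frobeniusForm r n l b b' s ^ e) * Y with hΦ₂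
  have hdeg₁ : Φ₁.totalDegree < n * (r - 1) := by
    have h1 := totalDegree_pow_le_of_le_one (e - 1 + i) (hLdeg a a' 0)
    have h2 := totalDegree_pow_le_of_le_one (e - i) (hLdeg b b' 0)
    have h3 := hprod a a'
    have h4 := hLdeg a a' 1
    refine lt_of_le_of_lt ((totalDegree_mul _ _).trans (add_le_add ((totalDegree_mul _ _).trans
      (add_le_add ((totalDegree_mul _ _).trans (add_le_add ((totalDegree_mul _ _).trans
      (add_le_add h4 h1)) h3)) h2)) hYdeg)) ?_
    omega
  have hdeg₂ : Φ₂.totalDegree ≤ n * (r - 1) := by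
    have h1 := totalDegree_pow_le_of_le_one (2 * e) (hLdeg a a' 0)
    have h2 := totalDegree_pow_le_of_le_one (2 * e) (hLdeg b b' 0)
    have h3 := hprod b b'
    refine ((totalDegree_mul _ _).trans (add_le_add ((totalDegree_mul _ _).trans
      (add_le_add ((totalDegree_mul _ _).trans (add_le_add h1 h2)) h3)) hYdeg)).trans ?_
    omega
  have hexp : (r ^ n - 1) / 2 + i =
      e + i + ∑ s ∈ Finset.univ.erase (0 : ZMod n), r ^ s.val * e := by
    have h1 := sum_sub_one_mul_pow_val n r (by omega)
    rw [← Finset.add_sum_erase _ _ (Finset.mem_univ (0 : ZMod n)), ZMod.val_zero,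
      pow_zero, mul_one] at h1
    have h2 : ∑ s ∈ Finset.univ.erase (0 : ZMod n), (r - 1) * r ^ s.val =
        2 * ∑ s ∈ Finset.univ.erase (0 : ZMod n), r ^ s.val * e := by
      rw [Finset.mul_sum]
      refine Finset.sum_congr rfl fun s _ => ?_
      rw [hrdef, Nat.add_sub_cancel]
      ring
    omega
  have hpow : ∀ x : F, x ^ ((r ^ n - 1) / 2 + i) =
      x ^ (e + i) * ∏ s ∈ Finset.univ.erase (0 : ZMod n), (x ^ r ^ s.val) ^ e := by
    intro x
    rw [hexp, pow_add, ← Finset.prod_pow_eq_pow_sum]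
    simp_rw [pow_mul]
  have heval : ∀ v ∈ V, eval (fun t : ZMod n => v ^ r ^ t.val) Φ₁ =
      c * eval (fun t : ZMod n => v ^ r ^ t.val) Φ₂ := by
    intro v hvV
    have hv := h v hvV
    rw [hV] at hvV
    simp only [hΦ₁, hΦ₂, map_mul, map_pow, map_prod, eval_frobeniusForm r n l hr hrodd _ _ _ hvV,
      ZMod.val_zero, ZMod.val_one'' hn1.ne', pow_zero, pow_one]
    rw [hpow, hpow] at hv
    set P := a * v ^ r ^ l + a' * v
    set R := b * v ^ r ^ l + b' * v
    have hP : P ^ r * P ^ (e - 1 + i) = P ^ (2 * e) * P ^ (e + i) := by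
      rw [← pow_add, ← pow_add]
      congr 1
      omega
    have hR : R ^ (2 * e) = R ^ (e + i) * R ^ (e - i) := by
      rw [← pow_add]
      congr 1
      omega
    rw [hP, hR]
    linear_combination P ^ (2 * e) * R ^ (e - i) *
      eval (fun t : ZMod n => v ^ r ^ t.val) Y * hv
  have hr2 : 2 ≤ r := by omega
  have hsum := Finset.sum_congr rfl heval
  rw [← Finset.mul_sum, sum_eval_frobenius_powers n r hr2 V hV hcard hu Φ₁ hdeg₁.le,
    sum_eval_frobenius_powers n r hr2 V hV hcard hu Φ₂ hdeg₂,
    coeff_eq_zero_of_totalDegree_lt (d := topDigits n r)] at hsum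
  · refine mul_ne_zero hc ?_ hsum.symm
    rw [hΦ₂, frobeniusForm_zero, frobeniusForm_zero]
    have hsign : ∀ k : ℕ, ((-1 : F)) ^ k ≠ 0 := fun k => pow_ne_zero _ (by simp)
    refine coeff_topDigits_prod_forms_ne_zero p d n e hr l hg Z h0Z hgZ hZ
      (mul_ne_zero ha (hsign _)) ?_ _ _
      (fun s => mul_ne_zero (pow_ne_zero _ hb) (hsign _)) (fun s => pow_ne_zero _ hb')
    rw [show a * (-1) ^ (l / n) * b' - a' * (b * (-1) ^ (l / n)) =
      (-1) ^ (l / n) * (a * b' - a' * b) by ring]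
    exact mul_ne_zero (hsign _) hdet
  · refine hdeg₁.trans_eq ?_
    rw [← sum_topDigits, ← Finsupp.sum_fintype (topDigits n r) (fun _ x => x) (fun _ => rfl)]
    rfl

section FiniteField

variable {F : Type*} [Field F] [Fintype F]

theorem exists_orderOf_eq_of_dvd {m : ℕ} (hm : m ∣ Fintype.card F - 1) :
    ∃ u : F, orderOf u = m := by
  classical
  obtain ⟨g, hg⟩ := isCyclic_iff_exists_orderOf_eq_natCard.1 (inferInstance : IsCyclic Fˣ)
  have hF := Fintype.one_lt_card (α := F)
  rw [Nat.card_eq_fintype_card, Fintype.card_units] at hg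
  obtain ⟨j, hj⟩ := hm
  have hj0 : j ≠ 0 := by
    rintro rfl
    omega
  refine ⟨(g ^ j : Fˣ), ?_⟩
  rw [orderOf_units, orderOf_pow_of_dvd hj0 (by rw [hg, hj]; exact dvd_mul_left _ _), hg, hj,
    Nat.mul_div_cancel _ (Nat.pos_of_ne_zero hj0)]

theorem exists_pow_eq_neg_one_of_dvd {m : ℕ} (hm : 2 * m ∣ Fintype.card F - 1) :
    ∃ c : F, c ^ m = -1 := by
  have hF := Fintype.one_lt_card (α := F)
  have hm0 : m ≠ 0 := by
    rintro rfl
    rw [mul_zero, zero_dvd_iff] at hm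
    omega
  obtain ⟨c, hc⟩ := exists_orderOf_eq_of_dvd hm
  refine ⟨c, (sq_eq_one_iff.1 ?_).resolve_left fun h => ?_⟩
  · rw [← pow_mul, mul_comm, ← hc, pow_orderOf_eq_one]
  · have := Nat.le_of_dvd (Nat.pos_of_ne_zero hm0) (hc ▸ orderOf_dvd_of_pow_eq_one h)
    omega

theorem pow_eq_neg_one_or_exists_sq {q : ℕ} (hq : Odd q) (hF : Fintype.card F = q ^ 2)
    (hchar : ringChar F ≠ 2) {x : F} (hx : x ≠ 0) (hxq : x ^ q = x) :
    x ^ ((q - 1) / 2) = -1 ∨ ∃ s : F, s ^ q = s ∧ x = s ^ 2 := by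
  obtain ⟨m, rfl⟩ := hq
  have h1 : x ^ (2 * m) = 1 := by
    rw [pow_succ] at hxq
    exact mul_right_cancel₀ hx (by rw [hxq, one_mul])
  rw [Nat.add_sub_cancel, Nat.mul_div_cancel_left _ two_pos]
  rcases sq_eq_one_iff.1 (show (x ^ m) ^ 2 = 1 by rw [← pow_mul, mul_comm, h1]) with h | h
  · right
    have hsq : IsSquare x := by
      rw [FiniteField.isSquare_iff hchar hx, hF,
        show (2 * m + 1) ^ 2 / 2 = 2 * m * (m + 1) by
          rw [show (2 * m + 1) ^ 2 = 2 * (2 * m * (m + 1)) + 1 by ring]; omega,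
        pow_mul, h1, one_pow]
    obtain ⟨s, rfl⟩ := hsq
    refine ⟨s, ?_, (sq s).symm⟩
    rw [pow_succ, pow_mul, sq, h, one_mul]
  · exact Or.inl h

theorem card_filter_pow_eq_neg (p m : ℕ) [Fact p.Prime] [CharP F p] [DecidableEq F]
    (hV : ∃ v : F, v ≠ 0 ∧ v ^ p ^ m = -v) :
    (((Finset.univ.filter fun v : F => v ^ p ^ m = -v).card : ℕ) : F) = 0 := by
  obtain ⟨w, hw0, hw⟩ := hV
  set V := Finset.univ.filter fun v : F => v ^ p ^ m = -v with hVdef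
  have hshift : ∑ v ∈ V, v = ∑ v ∈ V, (v + w) := by
    refine Finset.sum_bij' (fun v _ => v - w) (fun v _ => v + w) ?_ ?_ ?_ ?_ ?_
    · intro v hv
      rw [hVdef, Finset.mem_filter_univ] at hv ⊢
      rw [sub_pow_char_pow, hv, hw]
      ring
    · intro v hv
      rw [hVdef, Finset.mem_filter_univ] at hv ⊢
      rw [add_pow_char_pow, hv, hw]
      ring
    all_goals simp
  rw [Finset.sum_add_distrib, Finset.sum_const, nsmul_eq_mul, left_eq_add] at hshift
  exact (mul_eq_zero.1 hshift).resolve_right hw0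

end FiniteField

theorem IsPlanarFn.eq_zero_of_polarization_eq_zero {F : Type*} [Field F] {p k l : ℕ}
    [Fact p.Prime] [CharP F p] {ε : F}
    (h : IsPlanarFn fun x : F => x ^ (p ^ l + p ^ k) + ε * x ^ (p ^ l + 1)) {x a : F} (ha : a ≠ 0)
    (hxa : x ^ p ^ l * (a ^ p ^ k + ε * a) + a ^ p ^ l * (x ^ p ^ k + ε * x) = 0) : x = 0 := by
  have hp : p ≠ 0 := (Fact.out : p.Prime).ne_zero
  refine (h a ha (a ^ (p ^ l + p ^ k) + ε * a ^ (p ^ l + 1))).unique ?_ ?_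
  · simp only [pow_add _ (p ^ l), pow_one, add_pow_char_pow]
    linear_combination hxa
  · simp [hp]

/-- Hilbert 90 for the quadratic extension `F` of the field with `q` elements. -/
theorem exists_pow_eq_mul_self {F : Type*} [Field F] {p k : ℕ} [Fact p.Prime] [CharP F p]
    (hqq : ∀ x : F, (x ^ p ^ k) ^ p ^ k = x) (hV : ∃ v : F, v ≠ 0 ∧ v ^ p ^ k = -v)
    (h2 : (2 : F) ≠ 0) {w : F} (hw : w ^ p ^ k * w = 1) : ∃ a : F, a ≠ 0 ∧ a ^ p ^ k = w * a := by
  have key : ∀ c : F, (c + w ^ p ^ k * c ^ p ^ k) ^ p ^ k = w * (c + w ^ p ^ k * c ^ p ^ k) := by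
    intro c
    rw [add_pow_char_pow, mul_pow, hqq, hqq]
    linear_combination -c ^ p ^ k * hw
  obtain ⟨v, hv0, hv⟩ := hV
  by_cases h : (1 : F) + w ^ p ^ k * 1 ^ p ^ k = 0
  · refine ⟨_, ?_, key v⟩
    rw [one_pow, mul_one] at h
    rw [hv, show v + w ^ p ^ k * -v = 2 * v by linear_combination -v * h]
    exact mul_ne_zero h2 hv0
  · exact ⟨_, h, key 1⟩

/-- If the binomial is planar and `u ↦ u ^ Q + u` maps onto the subfield with `q` elements, then
a certain product of two linear binomials is never `1 - ε ^ (q + 1)` times a square in that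
subfield. -/
theorem mul_ne_mul_sq_of_isPlanarFn {F : Type*} [Field F] {p k l : ℕ} [Fact p.Prime]
    [CharP F p] (hodd : Odd p) (h2 : (2 : F) ≠ 0) (hqq : ∀ x : F, (x ^ p ^ k) ^ p ^ k = x)
    {ε γ : F} (hγ0 : γ ≠ 0) (hγ : γ ^ 2 = ε ^ (p ^ k + 1))
    (hplanar : IsPlanarFn fun x : F => x ^ (p ^ l + p ^ k) + ε * x ^ (p ^ l + 1))
    (hsurj : ∀ s : F, s ^ p ^ k = s → ∃ u, u ^ p ^ k = u ∧ u ^ p ^ l + u = s)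
    {v s : F} (hv0 : v ≠ 0) (hv : v ^ p ^ k = -v) (hs : s ^ p ^ k = s) :
    ((1 - γ) * v ^ p ^ l + -(1 + γ) * v) * ((1 + γ) * v ^ p ^ l + -(1 - γ) * v) ≠
      (1 - ε ^ (p ^ k + 1)) * s ^ 2 := by
  intro h
  obtain ⟨u, hu, rfl⟩ := hsurj s hs
  have hcomm : ∀ x : F, (x ^ p ^ l) ^ p ^ k = (x ^ p ^ k) ^ p ^ l := fun x => pow_right_comm _ _ _
  have hneg : (-v) ^ p ^ l = -v ^ p ^ l := hodd.pow.neg_pow v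
  set A := (u + v) ^ p ^ l + (u + v) with hA
  set B := (u + v) ^ p ^ l + (u + v) ^ p ^ k with hB
  have hA' : A = u ^ p ^ l + u + (v ^ p ^ l + v) := by rw [hA, add_pow_char_pow]; ring
  have hB' : B = u ^ p ^ l + u + (v ^ p ^ l - v) := by
    rw [hB, add_pow_char_pow, add_pow_char_pow, hu, hv]; ring
  have hAq : A ^ p ^ k = u ^ p ^ l + u - (v ^ p ^ l + v) := by
    rw [hA']
    simp only [add_pow_char_pow, hcomm, hu, hv, hneg]
    ring
  have hBq : B ^ p ^ k = u ^ p ^ l + u - (v ^ p ^ l - v) := by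
    rw [hB']
    simp only [add_pow_char_pow, sub_pow_char_pow, hcomm, hu, hv, hneg]
    ring
  have hN : B ^ p ^ k * B = ε ^ (p ^ k + 1) * (A ^ p ^ k * A) := by
    rw [hAq, hBq, hA', hB']
    rw [← hγ] at h ⊢
    linear_combination -h
  have hy0 : u + v ≠ 0 := by
    intro h0
    have : 2 * v = 0 := by
      have h1 := congrArg (· ^ p ^ k) h0
      simp only [add_pow_char_pow, hu, hv,
        zero_pow (pow_ne_zero k (Fact.out : p.Prime).ne_zero)] at h1
      linear_combination h0 - h1
    exact mul_ne_zero h2 hv0 this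
  have hAB : A ≠ 0 ∨ B ≠ 0 := by
    by_contra! h0
    exact mul_ne_zero h2 hv0 (by linear_combination h0.1 - h0.2 - hA' + hB')
  have hε : ε ^ (p ^ k + 1) ≠ 0 := hγ ▸ pow_ne_zero 2 hγ0
  have hB0 : B ≠ 0 := by
    intro hB0
    rw [hB0, mul_zero] at hN
    have hA0 := (mul_eq_zero.1 hN.symm).resolve_left hε
    rw [← pow_succ] at hA0
    exact (hAB.resolve_right (not_not.2 hB0)) (pow_eq_zero_iff (by omega) |>.1 hA0)
  obtain ⟨a, ha0, ha⟩ := exists_pow_eq_mul_self (w := -ε * A / B) hqq ⟨v, hv0, hv⟩ h2 (by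
    rw [div_pow, mul_pow, hodd.pow.neg_pow, div_mul_div_comm, hN, div_eq_one_iff_eq]
    · rw [pow_succ]; ring
    · rw [← hN]
      exact mul_ne_zero (pow_ne_zero _ hB0) hB0)
  have haB : a ^ p ^ k * B + ε * a * A = 0 := by
    rw [ha]
    field_simp
    ring
  refine mul_ne_zero ha0 hy0 (hplanar.eq_zero_of_polarization_eq_zero ha0 ?_)
  rw [mul_pow, mul_pow]
  rw [hA, hB] at haB
  linear_combination a ^ p ^ l * haB

theorem pow_pow_pow_of_pow_eq {F : Type*} [Field F] {x : F} {q : ℕ} (hx : x ^ q = x) (m : ℕ) :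
    x ^ q ^ m = x := by
  induction m with
  | zero => simp
  | succ m ih => rw [pow_succ, pow_mul, ih, hx]

/-- If `k / gcd(k, l)` is even, then `-1` is a `p ^ l - 1`-st power in the field with `p ^ k`
elements, so the binomial is not planar. -/
theorem not_isPlanarFn_of_even {F : Type*} [Field F] [Fintype F] {p d n l : ℕ} [Fact p.Prime]
    [CharP F p] (hodd : Odd p) (hF : Fintype.card F = ((p ^ d) ^ n) ^ 2) (hn : Even n)
    (hl : Odd l) (ε : F) :
    ¬ IsPlanarFn fun x : F => x ^ (p ^ (d * l) + p ^ (d * n)) + ε * x ^ (p ^ (d * l) + 1) := by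
  intro hplanar
  have hr : Odd (p ^ d) := hodd.pow
  have hdvd : 2 * (p ^ d - 1) ∣ Fintype.card F - 1 := by
    have h1 : (p ^ d) ^ 2 - 1 ∣ Fintype.card F - 1 := by
      rw [hF, pow_right_comm (p ^ d)]
      simpa using Nat.sub_dvd_pow_sub_pow ((p ^ d) ^ 2) 1 n
    refine dvd_trans ?_ h1
    obtain ⟨m, hm⟩ := hr
    rw [hm]
    refine ⟨m + 1, ?_⟩
    rw [show (2 * m + 1) ^ 2 = 2 * (2 * m) * (m + 1) + 1 by ring, Nat.add_sub_cancel,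
      Nat.add_sub_cancel]
  obtain ⟨c, hc⟩ := exists_pow_eq_neg_one_of_dvd hdvd
  have hcr : c ^ (p ^ d) ^ 1 = -c := by
    rw [pow_one, ← Nat.sub_add_cancel hr.pos, pow_succ, hc, neg_one_mul]
  have hpow : ∀ m, c ^ (p ^ d) ^ m = (-1) ^ m * c := by
    intro m
    simpa [Nat.mod_one] using pow_pow_eq_of_pow_eq_neg hr hcr m
  have hc0 : c ≠ 0 := by
    rintro rfl
    obtain ⟨m, hm⟩ := hr
    by_cases hm0 : p ^ d - 1 = 0
    · rw [hm0, pow_zero] at hc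
      have : (2 : F) = 0 := by linear_combination hc
      refine Ring.two_ne_zero ?_ this
      rw [ringChar.eq F p]
      rintro rfl
      exact absurd hodd (by decide)
    · rw [zero_pow hm0] at hc
      exact neg_ne_zero.2 one_ne_zero hc.symm
  refine hc0 (hplanar.eq_zero_of_polarization_eq_zero one_ne_zero ?_)
  rw [pow_mul p d l, pow_mul p d n, hpow, hpow, hn.neg_one_pow, hl.neg_one_pow]
  simp only [one_pow]
  ring

/-- If `k / gcd(k, l)` is odd, then `u ↦ u ^ p ^ l + u` is a bijection of the field with `p ^ k`
elements. -/
theorem exists_pow_add_self_eq {F : Type*} [Field F] [Finite F] {p d n l : ℕ} [Fact p.Prime]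
    [CharP F p] (hodd : Odd p) (h2 : (2 : F) ≠ 0) (hn : Odd n) (s : F)
    (hs : s ^ p ^ (d * n) = s) :
    ∃ u, u ^ p ^ (d * n) = u ∧ u ^ p ^ (d * l) + u = s := by
  let K : AddSubgroup F :=
    { carrier := {x | x ^ p ^ (d * n) = x}
      zero_mem' := zero_pow (pow_ne_zero _ (Fact.out : p.Prime).ne_zero)
      add_mem' := fun {x y} hx hy => by
        simp only [Set.mem_ofPred_eq] at hx hy ⊢
        rw [add_pow_char_pow, hx, hy]
      neg_mem' := fun {x} hx => by
        simp only [Set.mem_ofPred_eq] at hx ⊢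
        rw [hodd.pow.neg_pow, hx] }
  let f : K → K := fun u => ⟨(u : F) ^ p ^ (d * l) + u, K.add_mem
    (by
      have hu : (u : F) ^ p ^ (d * n) = u := u.2
      change ((u : F) ^ p ^ (d * l)) ^ p ^ (d * n) = (u : F) ^ p ^ (d * l)
      rw [pow_right_comm, hu]) u.2⟩
  have hinj : Function.Injective f := by
    intro u w huw
    have huw' : (u : F) ^ p ^ (d * l) + u = (w : F) ^ p ^ (d * l) + w := congrArg Subtype.val huw
    have hx : ((u - w : K) : F) ^ p ^ (d * n) = (u - w : K) := (u - w).2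
    set x : F := ((u - w : K) : F) with hxdef
    have hxl : x ^ (p ^ (d * l)) ^ 1 = -x := by
      rw [pow_one, hxdef, AddSubgroup.coe_sub, sub_pow_char_pow]
      linear_combination huw'
    have h1 : x ^ (p ^ (d * l)) ^ n = -x := by
      simpa [Nat.mod_one, hn.neg_one_pow] using
        pow_pow_eq_of_pow_eq_neg (hodd.pow : Odd (p ^ (d * l))) hxl n
    have h3 : x ^ (p ^ (d * l)) ^ n = x := by
      rw [← pow_mul p, mul_right_comm, pow_mul p]
      exact pow_pow_pow_of_pow_eq hx l
    have hx0 : x = 0 := by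
      refine (mul_eq_zero.1 (?_ : (2 : F) * x = 0)).resolve_left h2
      linear_combination h1 - h3
    exact sub_eq_zero.1 (Subtype.ext hx0)
  obtain ⟨u, hu⟩ := Finite.surjective_of_injective hinj ⟨s, hs⟩
  exact ⟨u, u.2, congrArg Subtype.val hu⟩

theorem not_isPlanarFn_of_odd {F : Type*} [Field F] [Fintype F] {p d n l : ℕ} [Fact p.Prime]
    [CharP F p] (hodd : Odd p) (hF : Fintype.card F = ((p ^ d) ^ n) ^ 2) (hd : d ≠ 0) (hn : Odd n)
    (hn1 : 1 < n) (hl : l.Coprime n) {ε : F} (hε : ε ≠ 0) (hε1 : ε ^ (p ^ (d * n) + 1) ≠ 1) :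
    ¬ IsPlanarFn fun x : F => x ^ (p ^ (d * l) + p ^ (d * n)) + ε * x ^ (p ^ (d * l) + 1) := by
  classical
  intro hplanar
  have : NeZero n := ⟨by omega⟩
  have hp1 : 1 < p := (Fact.out : p.Prime).one_lt
  have hchar : ringChar F ≠ 2 := by
    rw [ringChar.eq F p]
    rintro rfl
    exact absurd hodd (by decide)
  have h2 : (2 : F) ≠ 0 := Ring.two_ne_zero hchar
  rw [← pow_mul p d n] at hF
  set q := p ^ (d * n) with hq
  have hqodd : Odd q := hodd.pow
  have hq1 : 1 < q := Nat.one_lt_pow (by positivity) hp1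
  have hqq : ∀ x : F, (x ^ q) ^ q = x := fun x => by
    rw [← pow_mul, ← sq, ← hF, FiniteField.pow_card]
  have hcard : Fintype.card F - 1 = (q - 1) * (q + 1) := by
    rw [hF, mul_comm, ← Nat.sq_sub_sq, one_pow]
  obtain ⟨u, hu⟩ : ∃ u : F, orderOf u = q - 1 :=
    exists_orderOf_eq_of_dvd (hcard ▸ dvd_mul_right _ _)
  have huq : u ^ q = u := by
    rw [← Nat.sub_add_cancel hq1.le, pow_succ, ← hu, pow_orderOf_eq_one, one_mul]
  obtain ⟨w, hw⟩ : ∃ w : F, w ^ (q - 1) = -1 := exists_pow_eq_neg_one_of_dvd (by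
    rw [hcard, mul_comm 2]
    exact mul_dvd_mul_left _ hqodd.add_one.two_dvd)
  have hwq : w ^ q = -w := by
    rw [← Nat.sub_add_cancel hq1.le, pow_succ, hw, neg_one_mul]
  have hw0 : w ≠ 0 := by
    rintro rfl
    rw [zero_pow (by omega)] at hw
    exact neg_ne_zero.2 one_ne_zero hw.symm
  set γ := ε ^ ((q + 1) / 2) with hγdef
  have hγ0 : γ ≠ 0 := pow_ne_zero _ hε
  have hγ : γ ^ 2 = ε ^ (q + 1) := by
    rw [hγdef, ← pow_mul, Nat.div_mul_cancel hqodd.add_one.two_dvd]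
  have hNq : (ε ^ (q + 1)) ^ q = ε ^ (q + 1) := by
    rw [pow_right_comm, pow_succ, hqq, pow_succ, mul_comm]
  have hN1 : 1 - ε ^ (q + 1) ≠ 0 := sub_ne_zero.2 hε1.symm
  have hγ1 : (1 - γ) * (1 + γ) ≠ 0 := by
    rw [← hγ] at hN1
    convert hN1 using 1
    ring
  have hγm : 1 - γ ≠ 0 := left_ne_zero_of_mul hγ1
  have hγp : 1 + γ ≠ 0 := right_ne_zero_of_mul hγ1
  have hγq : γ ^ q = γ ∨ γ ^ q = -γ := by
    rw [← sq_eq_sq_iff_eq_or_eq_neg, ← pow_right_comm, hγ, hNq]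
  have hsurj : ∀ s : F, s ^ q = s → ∃ u, u ^ q = u ∧ u ^ p ^ (d * l) + u = s :=
    exists_pow_add_self_eq hodd h2 hn
  set c := (1 - ε ^ (q + 1)) ^ ((q - 1) / 2) with hcdef
  have hc0 : c ≠ 0 := pow_ne_zero _ hN1
  have key : ∀ v : F, v ^ q = -v → v ≠ 0 →
      ∀ P R : F, P = (1 - γ) * v ^ p ^ (d * l) + -(1 + γ) * v →
        R = (1 + γ) * v ^ p ^ (d * l) + -(1 - γ) * v →
        (P * R) ^ q = P * R → P ^ ((q - 1) / 2) * R ^ ((q - 1) / 2) = -c := by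
    rintro v hv hv0 P R rfl rfl hPR
    have hne := fun s hs => mul_ne_mul_sq_of_isPlanarFn (s := s) hodd h2 hqq hγ0 hγ hplanar hsurj
      hv0 hv hs
    set P := (1 - γ) * v ^ p ^ (d * l) + -(1 + γ) * v
    set R := (1 + γ) * v ^ p ^ (d * l) + -(1 - γ) * v
    have hx0 : P * R / (1 - ε ^ (q + 1)) ≠ 0 := by
      refine div_ne_zero (fun h => hne 0 (zero_pow (by omega)) ?_) hN1
      rw [h]
      ring
    have hxq : (P * R / (1 - ε ^ (q + 1))) ^ q = P * R / (1 - ε ^ (q + 1)) := by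
      rw [div_pow, hPR, sub_pow_char_pow, one_pow, hNq]
    rcases pow_eq_neg_one_or_exists_sq hqodd hF hchar hx0 hxq with h | ⟨s, hs, h⟩
    · rw [div_pow, ← hcdef, div_eq_iff hc0, mul_pow] at h
      rw [h, neg_one_mul]
    · rw [div_eq_iff hN1] at h
      exact absurd (by rw [h, mul_comm]) (hne s hs)
  obtain ⟨i, hi, hforms⟩ : ∃ i ≤ 1, ∀ v : F, v ^ q = -v →
      ((1 - γ) * v ^ p ^ (d * l) + -(1 + γ) * v) ^ ((q - 1) / 2 + i) =
        c * ((1 + γ) * v ^ p ^ (d * l) + -(1 - γ) * v) ^ ((q - 1) / 2 + i) := by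
    have hhalf : (q - 1) / 2 + ((q - 1) / 2 + 1) = q := by
      obtain ⟨m, hm⟩ := hqodd
      omega
    have hm0 : (q - 1) / 2 ≠ 0 := by
      obtain ⟨m, hm⟩ := hqodd
      omega
    have hQv : ∀ v : F, v ^ q = -v → (v ^ p ^ (d * l)) ^ q = -v ^ p ^ (d * l) := by
      intro v hv
      rw [pow_right_comm, hv, hodd.pow.neg_pow]
    have hlin : ∀ x y v : F, v ^ q = -v → (x * v ^ p ^ (d * l) + y * v) ^ q =
        -(x ^ q * v ^ p ^ (d * l) + y ^ q * v) := by
      intro x y v hv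
      rw [add_pow_char_pow, mul_pow, mul_pow, hQv v hv, hv]
      ring
    have hmq : (1 - γ) ^ q = 1 - γ ^ q := by rw [sub_pow_char_pow, one_pow]
    have hpq : (1 + γ) ^ q = 1 + γ ^ q := by rw [add_pow_char_pow, one_pow]
    have hpz : p ^ (d * l) ≠ 0 := by positivity
    rcases hγq with hγq | hγq
    · refine ⟨0, zero_le_one, fun v hv => ?_⟩
      by_cases hv0 : v = 0
      · simp [hv0, zero_pow hpz, zero_pow hm0]
      set P := (1 - γ) * v ^ p ^ (d * l) + -(1 + γ) * v with hP
      set R := (1 + γ) * v ^ p ^ (d * l) + -(1 - γ) * v with hR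
      have hPq : P ^ q = -P := by
        rw [hP, hlin _ _ v hv, hqodd.neg_pow, hmq, hpq, hγq]
      have hRq : R ^ q = -R := by
        rw [hR, hlin _ _ v hv, hqodd.neg_pow, hmq, hpq, hγq]
      have h := key v hv hv0 P R hP hR (by rw [mul_pow, hPq, hRq]; ring)
      have hR0 : R ≠ 0 := by
        intro h0
        rw [h0, zero_pow hm0, mul_zero] at h
        exact neg_ne_zero.2 hc0 h.symm
      rw [← hhalf, pow_add, pow_succ] at hRq
      apply mul_right_cancel₀ hR0
      rw [add_zero]
      linear_combination -R * R ^ ((q - 1) / 2) * h + P ^ ((q - 1) / 2) * hRq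
    · refine ⟨1, le_rfl, fun v hv => ?_⟩
      by_cases hv0 : v = 0
      · simp [hv0, zero_pow hpz]
      set P := (1 - γ) * v ^ p ^ (d * l) + -(1 + γ) * v with hP
      set R := (1 + γ) * v ^ p ^ (d * l) + -(1 - γ) * v with hR
      have hPq : P ^ q = -R := by
        rw [hP, hR, hlin _ _ v hv, hqodd.neg_pow, hmq, hpq, hγq]
        ring
      have hRq : R ^ q = -P := by
        rw [hP, hR, hlin _ _ v hv, hqodd.neg_pow, hmq, hpq, hγq]
        ring
      have h := key v hv hv0 P R hP hR (by rw [mul_pow, hPq, hRq]; ring)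
      rw [← hhalf, pow_add, pow_succ] at hRq
      rw [pow_succ, pow_succ]
      linear_combination -R * R ^ ((q - 1) / 2) * h + P ^ ((q - 1) / 2) * hRq
  obtain ⟨e, he⟩ : Odd (p ^ d) := hodd.pow
  have he1 : 1 ≤ e := by
    have : 1 < p ^ d := Nat.one_lt_pow hd hp1
    omega
  rw [hq, pow_mul, he] at hu huq hforms
  rw [pow_mul, he] at hforms
  refine false_of_pow_eq_mul_pow p d n l e i he.symm he1 hn hn1 hl
    (Finset.univ.filter fun v : F => v ^ (2 * e + 1) ^ n = -v) (fun v => Finset.mem_filter_univ v)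
    ?_ ⟨u, huq, hu⟩ hγm hγp (neg_ne_zero.2 hγm) ?_ hc0 hi
    (fun v hv => hforms v ((Finset.mem_filter_univ v).1 hv))
  · rw [← he, ← pow_mul]
    exact card_filter_pow_eq_neg p (d * n) ⟨w, hw0, hwq⟩
  · rw [show (1 - γ) * -(1 - γ) - -(1 + γ) * (1 + γ) = 2 * (2 * γ) by ring]
    exact mul_ne_zero h2 (mul_ne_zero h2 hγ0)

end Planarity

theorem stmt17 (p k ℓ : ℕ) (hp : p.Prime) (hodd : Odd p) (hk : 0 < k) (hl : 0 < ℓ)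
    (hndvd : ¬ k ∣ ℓ) (q Q : ℕ) (hq : q = p ^ k) (hQ : Q = p ^ ℓ)
    (F : Type) [Field F] [Fintype F] (hF : Fintype.card F = p ^ (2 * k))
    (ε : F) (hε : ε ≠ 0) (hε1 : ε ^ (q + 1) ≠ 1) :
    ¬ IsPlanarFn (fun x : F => x ^ (Q + q) + ε * x ^ (Q + 1)) := by
  subst hq hQ
  have : Fact p.Prime := ⟨hp⟩
  have : CharP F p := charP_of_card_eq_prime_pow hF
  obtain ⟨d, n, l, hd, hcop, rfl, rfl⟩ :
      ∃ d n l, 0 < d ∧ Nat.Coprime n l ∧ k = d * n ∧ ℓ = d * l := by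
    obtain ⟨d, n, l, hd, hcop, hk', hl'⟩ := Nat.exists_coprime' (Nat.gcd_pos_of_pos_left ℓ hk)
    exact ⟨d, n, l, hd, hcop, by rw [hk', mul_comm], by rw [hl', mul_comm]⟩
  have hF' : Fintype.card F = ((p ^ d) ^ n) ^ 2 := by
    rw [hF, ← pow_mul, ← pow_mul, mul_comm 2, mul_assoc]
  rcases Nat.even_or_odd n with hn | hn
  · refine not_isPlanarFn_of_even hodd hF' hn ?_ ε
    by_contra hl'
    exact Nat.not_coprime_of_dvd_of_dvd one_lt_two hn.two_dvd
      (Nat.not_odd_iff_even.1 hl').two_dvd hcop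
  · refine not_isPlanarFn_of_odd hodd hF' hd.ne' hn ?_ hcop.symm hε hε1
    by_contra hn1
    have : n = 1 := by
      have := hn.pos
      omega
    exact hndvd (by rw [this, mul_one]; exact dvd_mul_right d l)
end

section
/- Let p be an odd prime and k, δ positive integers with δ dividing k, k/δ odd and k/δ ≥ 3, and set q = p^k. Then for every ε ∈ F_q with ε ≠ 0 and ε ≠ −1, there exist t ∈ F_q with t ∉ {0, 1, −ε^{−1}} and Z ∈ F_q^* such that Z^{p^δ − 1} = −(ε+1)·t · ((1 + ε·t)·(1 − t))^{−1}. -/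
open Polynomial in
/-- Comparing the two highest coefficients of `(X - α) ^ A * (1 - β * X ^ N) ^ H` recovers `α`. -/
lemma eq_of_mul_pow_add_mul_pow_eq_zero {E : Type*} [Field E] {α α' β β' : E} {A N H : ℕ}
    (hN : 2 ≤ N) (hA : (A : E) ≠ 0) (hβ : β ≠ 0) (hβ' : β' ≠ 0)
    (h : (X - C α) ^ A * (1 - C β * X ^ N) ^ H
      + (X - C α') ^ A * (1 - C β' * X ^ N) ^ H = 0) : α = α' := by
  have hmon (b : E) : (X ^ N - C b).Monic := monic_X_pow_sub_C b (by omega)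
  have hmonic (a b : E) : ((X - C a) ^ A * (X ^ N - C b) ^ H).Monic :=
    ((monic_X_sub_C a).pow A).mul ((hmon b).pow H)
  have hfac (a : E) {b : E} (hb : b ≠ 0) : (X - C a) ^ A * (1 - C b * X ^ N) ^ H
      = C ((-b) ^ H) * ((X - C a) ^ A * (X ^ N - C b⁻¹) ^ H) := by
    have : 1 - C b * X ^ N = C (-b) * (X ^ N - C b⁻¹) := by
      have : C b * C b⁻¹ = 1 := by rw [← C_mul, mul_inv_cancel₀ hb, C_1]
      rw [C_neg]
      linear_combination -this
    rw [this, mul_pow, C_pow]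
    ring
  have hnext (a b : E) : ((X - C a) ^ A * (X ^ N - C b) ^ H).nextCoeff = A * (-a) := by
    rw [((monic_X_sub_C a).pow A).nextCoeff_mul ((hmon b).pow H),
      (monic_X_sub_C a).nextCoeff_pow, (hmon b).nextCoeff_pow, nextCoeff_X_sub_C]
    have : (X ^ N - C b).nextCoeff = 0 := by
      rw [nextCoeff_of_natDegree_pos (by rw [natDegree_X_pow_sub_C]; omega),
        natDegree_X_pow_sub_C, coeff_sub, coeff_X_pow, coeff_C]
      rw [if_neg (by omega), if_neg (by omega), sub_zero]
    rw [this]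
    simp
  rw [hfac α hβ, hfac α' hβ', add_eq_zero_iff_eq_neg, ← neg_mul, ← C_neg] at h
  have hlead := congrArg leadingCoeff h
  rw [leadingCoeff_mul_monic (hmonic _ _), leadingCoeff_mul_monic (hmonic _ _),
    leadingCoeff_C, leadingCoeff_C] at hlead
  rw [← hlead] at h
  have hU := mul_left_cancel₀ (C_ne_zero.mpr (pow_ne_zero H (neg_ne_zero.mpr hβ))) h
  have := congrArg nextCoeff hU
  rw [hnext, hnext] at this
  exact neg_injective (mul_left_cancel₀ hA this)

open Polynomial in
/-- A polynomial of small degree vanishing at all nonzero `d`-th powers of a finite field is zero. -/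
lemma eq_zero_of_eval_pow_eq_zero {K E : Type*} [Field K] [Fintype K] [Field E] [Algebra K E]
    {S : E[X]} {d : ℕ} (hd : 0 < d) (hdeg : S.natDegree * d < Fintype.card K - 1)
    (hS : ∀ Z : K, Z ≠ 0 → S.eval (algebraMap K E (Z ^ d)) = 0) : S = 0 := by
  classical
  rw [← expand_eq_zero hd]
  apply eq_zero_of_natDegree_lt_card_of_eval_eq_zero' _
    ((Finset.univ.erase (0 : K)).map ⟨algebraMap K E, (algebraMap K E).injective⟩)
  · intro x hx
    obtain ⟨Z, hZ, rfl⟩ := Finset.mem_map.mp hx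
    rw [expand_eval, Function.Embedding.coeFn_mk, ← map_pow]
    exact hS Z (Finset.ne_of_mem_erase hZ)
  · rwa [natDegree_expand, Finset.card_map, Finset.card_erase_of_mem (Finset.mem_univ _),
      Finset.card_univ]

open Polynomial in
/-- Two elements `α`, `α'` for which `w - α` and `w - α'` have opposite `μ`-th powers at all
nonzero `(Q - 1)`-th powers `w` are equal; here `Q = 2 * H + 1` and `μ` is `(q - 1) / 2` or
`(q + 1) / 2`. -/
lemma eq_of_sub_pow_eq_neg {K E : Type*} [Field K] [Fintype K] [Field E] [Algebra K E]
    {p b H N τ : ℕ} [Fact p.Prime] [CharP E p] {α α' : E} (hα : α ≠ 0) (hα' : α' ≠ 0)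
    (hH : 0 < H) (hN : 2 ≤ N) (hτ : τ ≤ 1) (hb : b ≠ 0) (hB : p ^ b = 2 * H * N + 1)
    (hQ : ((2 * H + 1 : ℕ) : E) = 0)
    (hcard : Fintype.card K = (2 * H + 1) * p ^ b)
    (h : ∀ Z : K, Z ≠ 0 →
      (algebraMap K E (Z ^ (2 * H)) - α) ^ (H * (N + p ^ b) + τ)
        = -(algebraMap K E (Z ^ (2 * H)) - α') ^ (H * (N + p ^ b) + τ)) : α = α' := by
  have hpE : (p : E) = 0 := CharP.cast_eq_zero E p
  have hNE : (N : E) = 1 := by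
    have := congrArg (Nat.cast : ℕ → E) hB
    push_cast [hpE, zero_pow hb] at this hQ
    linear_combination (N : E) * hQ + this
  have hA : ((H * N + τ : ℕ) : E) ≠ 0 := by
    intro h0
    push_cast [hNE] at h0 hQ
    have : (1 : E) = 0 := by
      interval_cases τ
      · push_cast at h0
        linear_combination hQ - 2 * h0
      · push_cast at h0
        linear_combination 2 * h0 - hQ
    exact one_ne_zero this
  refine eq_of_mul_pow_add_mul_pow_eq_zero (H := H) hN hA (pow_ne_zero (p ^ b) hα)
    (pow_ne_zero (p ^ b) hα') (eq_zero_of_eval_pow_eq_zero (K := K) (d := 2 * H) (by omega) ?_ ?_)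
  · have hdeg (a c : E) : ((X - C a) ^ (H * N + τ) * (1 - C c * X ^ N) ^ H).natDegree
        ≤ p ^ b := by
      have : ((X - C a) ^ (H * N + τ) * (1 - C c * X ^ N) ^ H).natDegree
          ≤ (H * N + τ) * 1 + H * N := by
        compute_degree
        rw [mul_one]
      rw [hB]
      nlinarith
    have := natDegree_add_le_of_degree_le (hdeg α (α ^ p ^ b)) (hdeg α' (α' ^ p ^ b))
    have h1 : 1 < p ^ b := by rw [hB]; nlinarith
    rw [hcard]
    calc _ ≤ p ^ b * (2 * H) := Nat.mul_le_mul_right _ this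
      _ < _ := by
        rw [Nat.add_mul, one_mul, mul_comm (p ^ b)]
        omega
  · intro Z hZ
    set w := algebraMap K E (Z ^ (2 * H)) with hw
    have hw1 : w ^ N * w ^ p ^ b = 1 := by
      have hexp : 2 * H * (N + p ^ b) = Fintype.card K - 1 := by
        rw [hcard, Nat.add_mul, one_mul, mul_add]
        omega
      rw [← pow_add, hw, ← map_pow, ← pow_mul, hexp, FiniteField.pow_card_sub_one_eq_one Z hZ,
        map_one]
    have key (a : E) : (w - a) ^ (H * N + τ) * (1 - a ^ p ^ b * w ^ N) ^ H
        = w ^ (N * H) * (w - a) ^ (H * (N + p ^ b) + τ) := by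
      have : 1 - a ^ p ^ b * w ^ N = w ^ N * (w - a) ^ p ^ b := by
        rw [sub_pow_char_pow]
        linear_combination -hw1
      rw [this]
      ring
    simp only [eval_add, eval_mul, eval_pow, eval_sub, eval_X, eval_C, eval_one]
    rw [key, key, h Z hZ]
    ring

/-- If `c ≠ ±1` then `w ^ 2 + 2 * c * w + 1` is a square for some nonzero `(Q - 1)`-th power `w`. -/
lemma exists_isSquare_sq_add_mul_add_one {K : Type*} [Field K] [Fintype K]
    {p b H N : ℕ} [Fact p.Prime] [CharP K p]
    (hH : 0 < H) (hN : 2 ≤ N) (hb : b ≠ 0) (hB : p ^ b = 2 * H * N + 1)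
    (hQ : ((2 * H + 1 : ℕ) : K) = 0)
    (hcard : Fintype.card K = (2 * H + 1) * p ^ b) {c : K} (hc : c ^ 2 ≠ 1) :
    ∃ Z : K, Z ≠ 0 ∧ IsSquare ((Z ^ (2 * H)) ^ 2 + 2 * c * Z ^ (2 * H) + 1) := by
  by_contra! hns
  let E := AlgebraicClosure K
  let φ := algebraMap K E
  have hchar : CharP E p := charP_of_injective_algebraMap φ.injective p
  have hQE : ((2 * H + 1 : ℕ) : E) = 0 := by
    rw [← map_natCast φ, hQ, map_zero]
  have h2 : ringChar K ≠ 2 := by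
    intro h
    have hz : (2 : K) = 0 := by
      have := ringChar.Nat.cast_ringChar (R := K)
      rw [h] at this
      exact_mod_cast this
    push_cast [hz] at hQ
    simp at hQ
  obtain ⟨α, hα⟩ : ∃ α : E, α ^ 2 + 2 * φ c * α + 1 = 0 := by
    obtain ⟨s, hs⟩ := IsAlgClosed.exists_pow_nat_eq (φ c ^ 2 - 1) (n := 2) (by norm_num)
    exact ⟨s - φ c, by linear_combination hs⟩
  have hα0 : α ≠ 0 := by
    rintro rfl
    simp at hα
  have hαinv : α * α⁻¹ = 1 := mul_inv_cancel₀ hα0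
  have hsum : α + α⁻¹ = -(2 * φ c) := by
    apply mul_right_cancel₀ hα0
    linear_combination hα + hαinv
  have hg (w : E) : (w - α) * (w - α⁻¹) = w ^ 2 + 2 * φ c * w + 1 := by
    linear_combination hαinv - w * hsum
  have hαne : α ≠ α⁻¹ := by
    intro h
    have h1 : α ^ 2 = 1 := by rw [sq]; nth_rw 2 [h]; exact hαinv
    apply hc
    apply φ.injective
    have h2E : (2 : E) ≠ 0 := by
      have := Ring.two_ne_zero h2
      intro h
      exact this (φ.injective (by rw [map_ofNat, map_zero, h]))
    have h3 : φ c * α = -1 := by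
      apply mul_left_cancel₀ h2E
      linear_combination hα - h1
    rw [map_pow, map_one]
    linear_combination (φ c * α - 1) * h3 - φ c ^ 2 * h1
  set q := Fintype.card K with hq
  set m := H * (N + p ^ b) with hm
  have hqm : q = 2 * m + 1 := by
    rw [hcard, hm]
    nlinarith
  have hfrob (x y : E) : (x - y) ^ q = x ^ q - y ^ q := by
    obtain ⟨r, -, hr⟩ := FiniteField.card K p
    rw [hq, hr, sub_pow_char_pow]
  have hφ (x : K) : φ x ^ q = φ x := by rw [← map_pow, FiniteField.pow_card]
  have hprod (Z : K) (hZ : Z ≠ 0) : (φ (Z ^ (2 * H)) - α) * (φ (Z ^ (2 * H)) - α⁻¹) ≠ 0 ∧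
      (φ (Z ^ (2 * H)) - α) ^ m * (φ (Z ^ (2 * H)) - α⁻¹) ^ m = -1 := by
    have hsq := hns Z hZ
    set u := (Z ^ (2 * H)) ^ 2 + 2 * c * Z ^ (2 * H) + 1 with hu
    have hu0 : u ≠ 0 := fun h => hsq (h ▸ IsSquare.zero)
    have hgu : (φ (Z ^ (2 * H)) - α) * (φ (Z ^ (2 * H)) - α⁻¹) = φ u := by
      rw [hg, hu]
      simp only [map_add, map_mul, map_pow, map_one, map_ofNat]
    have hum : u ^ m = -1 := by
      have hm2 : Fintype.card K / 2 = m := by omega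
      have := FiniteField.pow_dichotomy h2 hu0
      rw [hm2] at this
      refine this.resolve_left fun h1 => hsq ?_
      rw [FiniteField.isSquare_iff h2 hu0, hm2, h1]
    rw [← mul_pow, hgu, ← map_pow, hum]
    exact ⟨by simpa using hu0, by simp⟩
  have hroots : α ^ q = α ∨ α ^ q = α⁻¹ := by
    have h0 : (α ^ q - α) * (α ^ q - α⁻¹) = 0 := by
      rw [hg]
      have hαq : α ^ q + (α⁻¹) ^ q = (-(2 * φ c)) ^ q := by
        rw [← hsum, ← sub_neg_eq_add α, hfrob, Odd.neg_pow ⟨m, hqm⟩, sub_neg_eq_add]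
      have h2q : (-(2 * φ c)) ^ q = -(2 * φ c) := by
        have := hφ (-(2 * c))
        simpa only [map_neg, map_mul, map_ofNat] using this
      have hinv : α ^ q * (α⁻¹) ^ q = 1 := by
        rw [← mul_pow, hαinv, one_pow]
      rw [h2q] at hαq
      linear_combination α ^ q * hαq - hinv
    rcases mul_eq_zero.mp h0 with h | h
    · exact .inl (sub_eq_zero.mp h)
    · exact .inr (sub_eq_zero.mp h)
  rcases hroots with hr | hr
  · refine hαne (eq_of_sub_pow_eq_neg (K := K) (τ := 0) hα0 (inv_ne_zero hα0) hH hN (by norm_num)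
      hb hB hQE hcard fun Z hZ => ?_)
    obtain ⟨h0, h1⟩ := hprod Z hZ
    change (φ (Z ^ (2 * H)) - α) ^ m = -(φ (Z ^ (2 * H)) - α⁻¹) ^ m
    have hx : (φ (Z ^ (2 * H)) - α) ^ q = φ (Z ^ (2 * H)) - α := by rw [hfrob, hφ, hr]
    set x := φ (Z ^ (2 * H)) - α
    have hx0 : x ≠ 0 := left_ne_zero_of_mul h0
    have hx1 : x ^ m * x ^ m = 1 := by
      apply mul_right_cancel₀ hx0
      rw [one_mul]
      nth_rw 4 [← hx]
      rw [hqm]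
      ring
    linear_combination (φ (Z ^ (2 * H)) - α⁻¹) ^ m * (-hx1) + x ^ m * h1
  · refine hαne (eq_of_sub_pow_eq_neg (K := K) (τ := 1) hα0 (inv_ne_zero hα0) hH hN le_rfl
      hb hB hQE hcard fun Z hZ => ?_)
    obtain ⟨h0, h1⟩ := hprod Z hZ
    change (φ (Z ^ (2 * H)) - α) ^ (m + 1) = -(φ (Z ^ (2 * H)) - α⁻¹) ^ (m + 1)
    have hx : (φ (Z ^ (2 * H)) - α) ^ q = φ (Z ^ (2 * H)) - α⁻¹ := by rw [hfrob, hφ, hr]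
    set x := φ (Z ^ (2 * H)) - α
    rw [← hx] at h1 ⊢
    have : (x ^ q) ^ (m + 1) = (x ^ m * (x ^ q) ^ m) * x ^ (m + 1) := by
      rw [← pow_mul, ← pow_mul, ← pow_add, ← pow_add]
      congr 1
      rw [hqm]
      ring
    rw [this, h1]
    ring

/-- A square value of `w ^ 2 + 2 * c * w + 1` with `c = (ε - 1) / (ε + 1)` makes the quadratic
equation for `t` solvable. -/
lemma exists_eq_of_isSquare {K : Type*} [Field K] (h2 : (2 : K) ≠ 0) {ε w : K} (hε : ε ≠ 0)
    (hε1 : ε + 1 ≠ 0) (hw : w ≠ 0)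
    (hsq : IsSquare (w ^ 2 + 2 * ((ε - 1) / (ε + 1)) * w + 1)) :
    ∃ t : K, t ≠ 0 ∧ t ≠ 1 ∧ t ≠ -ε⁻¹ ∧
      w⁻¹ = -((ε + 1) * t) * ((1 + ε * t) * (1 - t))⁻¹ := by
  obtain ⟨s, hs⟩ := hsq
  have hs' : (ε + 1) * w ^ 2 + 2 * (ε - 1) * w + (ε + 1) = (ε + 1) * s ^ 2 := by
    field_simp at hs
    linear_combination hs
  obtain ⟨t, ht⟩ : ∃ t : K, ε * t ^ 2 - ((ε - 1) + (ε + 1) * w) * t - 1 = 0 := by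
    refine ⟨((ε - 1) + (ε + 1) * w + (ε + 1) * s) / (2 * ε), ?_⟩
    field_simp
    linear_combination -(ε + 1) * hs'
  have ht0 : t ≠ 0 := by
    rintro rfl
    simp at ht
  have ht1 : 1 - t ≠ 0 := by
    intro h
    have : (ε + 1) * w = 0 := by
      obtain rfl : t = 1 := (sub_eq_zero.mp h).symm
      linear_combination -ht
    exact mul_ne_zero hε1 hw this
  have ht2 : 1 + ε * t ≠ 0 := by
    intro h
    have : (ε + 1) * w * t = 0 := by linear_combination -ht + (t - 1) * h
    exact mul_ne_zero (mul_ne_zero hε1 hw) ht0 this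
  refine ⟨t, ht0, fun h => ht1 (by rw [h, sub_self]), fun h => ht2 ?_, ?_⟩
  · rw [h, mul_neg, mul_inv_cancel₀ hε, add_neg_cancel]
  · field_simp
    linear_combination -ht

theorem stmt19 (p k δ : ℕ) (hp : p.Prime) (hodd : Odd p) (hk : 0 < k) (hδ : 0 < δ)
    (hdvd : δ ∣ k) (hkodd : Odd (k / δ)) (hk3 : 3 ≤ k / δ)
    (q : ℕ) (hq : q = p ^ k)
    (K : Type) [Field K] [Fintype K] (hK : Fintype.card K = p ^ k) :
    ∀ ε : K, ε ≠ 0 → ε ≠ -1 →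
      ∃ t : K, t ≠ 0 ∧ t ≠ 1 ∧ t ≠ -ε⁻¹ ∧
        ∃ Z : K, Z ≠ 0 ∧ Z ^ (p ^ δ - 1) = -((ε + 1) * t) * ((1 + ε * t) * (1 - t))⁻¹ := by
  intro ε hε hε1
  have : Fact p.Prime := ⟨hp⟩
  have : CharP K p := charP_of_card_eq_prime_pow hK
  obtain ⟨n, rfl⟩ := hdvd
  rw [Nat.mul_div_cancel_left n hδ] at hk3
  obtain ⟨l, rfl⟩ : ∃ l, n = l + 3 := ⟨n - 3, by omega⟩
  obtain ⟨H, hH⟩ : Odd (p ^ δ) := hodd.pow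
  have hQ1 : 1 < p ^ δ := Nat.one_lt_pow hδ.ne' hp.one_lt
  have hH0 : 0 < H := by omega
  obtain ⟨N, hN⟩ : p ^ δ - 1 ∣ p ^ (δ * (l + 2)) - 1 := by
    rw [pow_mul]
    simpa using Nat.sub_dvd_pow_sub_pow (p ^ δ) 1 (l + 2)
  have hpos : 0 < p ^ (δ * (l + 2)) := pow_pos hp.pos _
  have hH' : p ^ δ - 1 = 2 * H := by omega
  have hB : p ^ (δ * (l + 2)) = 2 * H * N + 1 := by
    rw [hH'] at hN
    omega
  have hN2 : 2 ≤ N := by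
    have hlt : p ^ δ < p ^ (δ * (l + 2)) := Nat.pow_lt_pow_right hp.one_lt (by nlinarith)
    by_contra! h
    interval_cases N <;> omega
  have hQ : ((2 * H + 1 : ℕ) : K) = 0 := by
    rw [← hH, Nat.cast_pow, CharP.cast_eq_zero, zero_pow hδ.ne']
  have h2 : (2 : K) ≠ 0 := by
    intro h
    push_cast [h] at hQ
    simp at hQ
  have hcard : Fintype.card K = (2 * H + 1) * p ^ (δ * (l + 2)) := by
    rw [hK, ← hH, ← pow_add]
    congr 1
    ring
  have hε1' : ε + 1 ≠ 0 := fun h => hε1 (eq_neg_of_add_eq_zero_left h)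
  have hc : ((ε - 1) / (ε + 1)) ^ 2 ≠ 1 := by
    intro h
    field_simp at h
    exact mul_ne_zero (mul_ne_zero h2 h2) hε (by linear_combination -h)
  obtain ⟨Z, hZ, hsq⟩ := exists_isSquare_sq_add_mul_add_one hH0 hN2
    (by positivity) hB hQ hcard hc
  obtain ⟨t, ht0, ht1, ht2, ht⟩ := exists_eq_of_isSquare h2 hε hε1' (pow_ne_zero _ hZ) hsq
  exact ⟨t, ht0, ht1, ht2, Z⁻¹, inv_ne_zero hZ, by rw [hH', inv_pow, ht]⟩
end
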